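/- arXiv:1006.4135 — 2 statements merged into one kernel-verified Lean document; each statement's English description precedes it below -/
import Mathlib

section
/- Every natural number n can be written as the sum of three (not necessarily distinct) triangular numbers, possibly including 0: there exist natural numbers a, b, c such that n = a(a+1)/2 + b(b+1)/2 + c(c+1)/2. -/
/-- The value at `(x, y, z)` of the ternary quadratic form with diagonal coefficients `a, b, c`
and off-diagonal coefficients `d` (`xy`), `e` (`xz`), `f` (`yz`), each counted twice. -/
def ternaryForm (a b c d e f x y z : ℤ) : ℤ :=
  a * x ^ 2 + b * y ^ 2 + c * z ^ 2 + 2 * d * x * y + 2 * e * x * z + 2 * f * y * z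

/-- Translating `d` by a multiple of `a > 0` makes it at most `a / 2` in absolute value. -/
theorem exists_abs_two_mul_add_mul_le (a d : ℤ) (ha : 0 < a) : ∃ k, |2 * (d + a * k)| ≤ a := by
  refine ⟨-((2 * d + a) / (2 * a)), ?_⟩
  have h₁ := Int.emod_add_mul_ediv (2 * d + a) (2 * a)
  have h₂ := Int.emod_nonneg (2 * d + a) (b := 2 * a) (by omega)
  have h₃ := Int.emod_lt_of_pos (2 * d + a) (b := 2 * a) (by omega)
  rw [abs_le]
  constructor <;> linarith

/-- A Hermite-reduced positive definite form of determinant one has `a = a * b - d ^ 2 = 1`. -/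
theorem eq_one_of_reduced {a b d g h m : ℤ} (ha : 0 < a) (hg : 0 < g) (hab : a ≤ b)
    (hgh : g ≤ h) (hd : |2 * d| ≤ a) (hm : |2 * m| ≤ g) (hgdef : a * b - d ^ 2 = g)
    (hdet : g * h - m ^ 2 = a) : a = 1 ∧ g = 1 := by
  have hd2 : 4 * d ^ 2 ≤ a ^ 2 := by
    have := sq_le_sq' (by linarith [abs_nonneg (2 * d)]) hd
    rw [sq_abs] at this; linarith
  have hm2 : 4 * m ^ 2 ≤ g ^ 2 := by
    have := sq_le_sq' (by linarith [abs_nonneg (2 * m)]) hm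
    rw [sq_abs] at this; linarith
  have h₁ : 3 * a ^ 2 ≤ 4 * g := by nlinarith
  have h₂ : 3 * g ^ 2 ≤ 4 * a := by nlinarith
  have ha1 : a < 2 := by
    by_contra! h
    rcases le_total a g with h' | h' <;> nlinarith
  obtain rfl : a = 1 := by omega
  refine ⟨rfl, ?_⟩
  by_contra h
  have : 2 ≤ g := by omega
  nlinarith

/-- Every value of a positive definite integral ternary form of determinant one is a sum of
three squares. -/
theorem exists_ternaryForm_eq_sum_three_sq (a b c d e f : ℤ) (ha : 0 < a)
    (hg : 0 < a * b - d ^ 2)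
    (hdet : (a * b - d ^ 2) * (a * c - e ^ 2) - (a * f - d * e) ^ 2 = a) (x y z : ℤ) :
    ∃ r s t : ℤ, ternaryForm a b c d e f x y z = r ^ 2 + s ^ 2 + t ^ 2 := by
  induction hA : a.toNat using Nat.strong_induction_on generalizing a b c d e f x y z with
  | _ A ihA =>
  induction hG : (a * b - d ^ 2).toNat using Nat.strong_induction_on
    generalizing a b c d e f x y z with
  | _ G ihG =>
  wlog hd : |2 * d| ≤ a generalizing b d f x
  · obtain ⟨k, hk⟩ := exists_abs_two_mul_add_mul_le a d ha
    have hgeq : a * (b + 2 * d * k + a * k ^ 2) - (d + a * k) ^ 2 = a * b - d ^ 2 := by ring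
    obtain ⟨r, s, t, h⟩ := this (b + 2 * d * k + a * k ^ 2) (d + a * k) (f + e * k)
      (by rwa [hgeq]) (by rw [hgeq]; linear_combination hdet) (x - k * y) (by rw [hgeq, hG]) hk
    refine ⟨r, s, t, h ▸ ?_⟩
    unfold ternaryForm; ring
  wlog hm : |2 * (a * f - d * e)| ≤ a * b - d ^ 2 generalizing c e f y
  · obtain ⟨k, hk⟩ := exists_abs_two_mul_add_mul_le (a * b - d ^ 2) (a * f - d * e) hg
    have hmeq : a * (f + b * k) - d * (e + d * k) = a * f - d * e + (a * b - d ^ 2) * k := by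
      ring
    obtain ⟨r, s, t, h⟩ := this (c + 2 * f * k + b * k ^ 2) (e + d * k) (y - k * z)
      (f + b * k) (by linear_combination hdet) (by rwa [hmeq])
    refine ⟨r, s, t, h ▸ ?_⟩
    unfold ternaryForm; ring
  rcases lt_or_ge b a with hba | hab
  · have hb : 0 < b := by nlinarith [sq_nonneg d]
    obtain ⟨r, s, t, h⟩ := ihA b.toNat (by omega) b a c d f e hb (by linarith)
      (by
        refine mul_left_cancel₀ ha.ne' ?_
        linear_combination b * hdet) y x z rfl
    refine ⟨r, s, t, h ▸ ?_⟩
    unfold ternaryForm; ring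
  rcases lt_or_ge (a * c - e ^ 2) (a * b - d ^ 2) with hlt | hge
  · have hpos : 0 < a * c - e ^ 2 := by nlinarith [sq_nonneg (a * f - d * e)]
    obtain ⟨r, s, t, h⟩ := ihG (a * c - e ^ 2).toNat (by omega) a c b e d f ha hpos
      (by linear_combination hdet) x z y hA rfl
    refine ⟨r, s, t, h ▸ ?_⟩
    unfold ternaryForm; ring
  obtain ⟨rfl, hg1⟩ := eq_one_of_reduced ha hg hab hge hd hm rfl hdet
  obtain rfl : d = 0 := by rw [abs_le] at hd; omega
  rw [hg1] at hm hdet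
  obtain rfl : f = 0 := by rw [abs_le] at hm; omega
  refine ⟨x + e * z, y, z, ?_⟩
  unfold ternaryForm
  linear_combination y ^ 2 * hg1 + z ^ 2 * hdet

open NumberTheorySymbols in
/-- If `2 * p = d * N - 1` with `p ≡ 1 [MOD 4]` and `d ≡ 1 [MOD 8]`, then `-d` is a quadratic
residue modulo `p`. -/
theorem jacobiSym_neg_eq_one {p d N : ℕ} (hp : p % 4 = 1) (hd : d % 8 = 1)
    (h : 2 * p + 1 = d * N) : J(-(d : ℤ) | p) = 1 := by
  have hpo : Odd p := Nat.odd_iff.2 (by omega)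
  have hdo : Odd d := Nat.odd_iff.2 (by omega)
  have h2 : J(-2 | d) = 1 := by
    rw [jacobiSym.at_neg_two hdo, ZMod.χ₈'_nat_eq_if_mod_eight]
    simp [hd]; omega
  have hprod : J(-2 * (p : ℤ) | d) = 1 := by
    rw [← jacobiSym.one_left d]
    refine jacobiSym.mod_left' (Int.emod_eq_emod_iff_emod_sub_eq_zero.2
      (Int.emod_eq_zero_of_dvd ⟨-N, ?_⟩))
    zify at h
    linear_combination -h
  rw [jacobiSym.neg _ hpo, ZMod.χ₄_nat_one_mod_four hp, one_mul,
    jacobiSym.quadratic_reciprocity_one_mod_four' hdo hp]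
  rwa [jacobiSym.mul_left, h2, one_mul] at hprod

/-- Every natural number congruent to `3` modulo `8` is a sum of three squares. -/
theorem exists_sum_three_sq_of_three_mod_eight (n : ℕ) :
    ∃ r s t : ℤ, (8 * n + 3 : ℤ) = r ^ 2 + s ^ 2 + t ^ 2 := by
  have hcop : (4 * n + 1).Coprime (4 * (8 * n + 3)) := by
    refine Nat.Coprime.mul_right ?_ ?_
    · simp
    · rw [show 8 * n + 3 = 1 + (4 * n + 1) * 2 by ring]
      simp
  obtain ⟨p, hgt, hp, hmod⟩ := Nat.forall_exists_prime_gt_and_modEq (4 * n + 1) (by omega) hcop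
  obtain ⟨j, hj⟩ := (Nat.modEq_iff_dvd' hgt.le).1 hmod.symm
  have hpj : p = 4 * (8 * n + 3) * j + (4 * n + 1) := by omega
  have hp4 : p % 4 = 1 := by
    rw [hpj, mul_assoc]; omega
  have hN : 2 * p + 1 = (8 * j + 1) * (8 * n + 3) := by rw [hpj]; ring
  have : Fact p.Prime := ⟨hp⟩
  have hsq := ZMod.isSquare_of_jacobiSym_eq_one (jacobiSym_neg_eq_one hp4 (by omega) hN)
  obtain ⟨u, hu⟩ := hsq
  obtain ⟨v, rfl⟩ := ZMod.intCast_surjective u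
  have hdvd : (p : ℤ) ∣ v ^ 2 + (8 * j + 1) := by
    rw [← ZMod.intCast_zmod_eq_zero_iff_dvd]
    push_cast at hu ⊢
    linear_combination -hu
  obtain ⟨w, hwodd, hw⟩ : ∃ w : ℤ, w % 2 = 1 ∧ (p : ℤ) ∣ w ^ 2 + (8 * j + 1) := by
    rcases Int.emod_two_eq_zero_or_one v with h | h
    · refine ⟨v + p, by omega, ?_⟩
      obtain ⟨k, hk⟩ := hdvd
      exact ⟨k + 2 * v + p, by linear_combination hk⟩
    · exact ⟨v, h, hdvd⟩
  have h2 : (2 : ℤ) ∣ w ^ 2 + (8 * j + 1) := by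
    obtain ⟨i, rfl⟩ : ∃ i, w = 2 * i + 1 := ⟨w / 2, by omega⟩
    exact ⟨2 * i ^ 2 + 2 * i + 4 * j + 1, by ring⟩
  obtain ⟨a, ha⟩ : (2 * p : ℤ) ∣ w ^ 2 + (8 * j + 1) := by
    refine IsCoprime.mul_dvd ?_ h2 hw
    rw [Int.isCoprime_iff_gcd_eq_one]
    exact (Nat.coprime_primes Nat.prime_two hp).2 (by omega)
  have hNz : (2 * p + 1 : ℤ) = (8 * j + 1) * (8 * n + 3) := by exact_mod_cast hN
  have hapos : 0 < a := by
    have : (0 : ℤ) < p := by exact_mod_cast hp.pos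
    by_contra! h
    nlinarith [sq_nonneg w]
  have hg : a * (2 * p) - w ^ 2 = 8 * j + 1 := by linear_combination -ha
  obtain ⟨r, s, t, h⟩ := exists_ternaryForm_eq_sum_three_sq a (2 * p) (8 * n + 3) w 1 0 hapos
    (by omega) (by linear_combination (a * (8 * n + 3) - 1) * hg - a * hNz - ha) 0 0 1
  exact ⟨r, s, t, by rw [← h]; simp [ternaryForm]⟩

/-- An odd integer square is `8` times a triangular number plus one. -/
theorem exists_sq_eq_eight_mul_triangular_add_one {r : ℤ} (hr : r % 2 = 1) :
    ∃ a : ℕ, r ^ 2 = 8 * (a * (a + 1) / 2 : ℕ) + 1 := by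
  obtain ⟨a, ha⟩ : ∃ a : ℕ, r.natAbs = 2 * a + 1 := ⟨r.natAbs / 2, by omega⟩
  refine ⟨a, ?_⟩
  have h2 : 2 * (a * (a + 1) / 2) = a * (a + 1) :=
    Nat.mul_div_cancel' (Nat.even_mul_succ_self a).two_dvd
  rw [← Int.natAbs_sq, ha]
  zify at h2
  push_cast
  linear_combination -4 * h2

/-- Gauss: every natural number is the sum of three (not necessarily distinct) triangular
numbers, possibly including `0`. -/
theorem sum_of_three_triangular (n : ℕ) :
    ∃ a b c : ℕ, n = a * (a + 1) / 2 + b * (b + 1) / 2 + c * (c + 1) / 2 := by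
  obtain ⟨r, s, t, h⟩ := exists_sum_three_sq_of_three_mod_eight n
  have sq_mod (w : ℤ) : w % 2 = 1 ∨ w ^ 2 % 8 = 0 ∨ w ^ 2 % 8 = 4 := by
    have : w % 8 = 0 ∨ w % 8 = 2 ∨ w % 8 = 4 ∨ w % 8 = 6 ∨ w % 2 = 1 := by omega
    rcases this with h | h | h | h | h <;> simp [pow_two, Int.mul_emod, h]
  have sq_mod_odd {w : ℤ} (hw : w % 2 = 1) : w ^ 2 % 8 = 1 := by
    obtain ⟨a, ha⟩ := exists_sq_eq_eight_mul_triangular_add_one hw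
    omega
  have hodd : r % 2 = 1 ∧ s % 2 = 1 ∧ t % 2 = 1 := by
    rcases sq_mod r with hr | hr <;> rcases sq_mod s with hs | hs <;>
      rcases sq_mod t with ht | ht <;> grind
  obtain ⟨a, ha⟩ := exists_sq_eq_eight_mul_triangular_add_one hodd.1
  obtain ⟨b, hb⟩ := exists_sq_eq_eight_mul_triangular_add_one hodd.2.1
  obtain ⟨c, hc⟩ := exists_sq_eq_eight_mul_triangular_add_one hodd.2.2
  exact ⟨a, b, c, by omega⟩
end

section
/- Let γ and δ be real numbers with γ ≥ 0, δ ≥ 0, γ + δ ≤ 1, δ < 1, and γ ≥ δ + γδ/(1 − δ). Then max(γ, δ, 1 − γ − δ) ≥ 3/8. Moreover the bound is sharp: γ = 3/8, δ = 1/4 satisfy all the constraints and give max(γ, δ, 1 − γ − δ) = 3/8. -/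
/-- If `γ, δ ≥ 0`, `γ + δ ≤ 1`, `δ < 1` and `γ ≥ δ + γδ/(1 - δ)`, then
`max (γ, δ, 1 - γ - δ) ≥ 3/8`; moreover the bound is sharp: `γ = 3/8`, `δ = 1/4` satisfy
all the constraints and give `max (γ, δ, 1 - γ - δ) = 3/8`. -/
theorem special_weighing_bound :
    (∀ γ δ : ℝ, 0 ≤ γ → 0 ≤ δ → γ + δ ≤ 1 → δ < 1 → δ + γ * δ / (1 - δ) ≤ γ →
      (3 / 8 : ℝ) ≤ max γ (max δ (1 - γ - δ))) ∧
    (0 ≤ (3 / 8 : ℝ) ∧ 0 ≤ (1 / 4 : ℝ) ∧ (3 / 8 : ℝ) + 1 / 4 ≤ 1 ∧ (1 / 4 : ℝ) < 1 ∧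
      (1 / 4 : ℝ) + (3 / 8) * (1 / 4) / (1 - 1 / 4) ≤ 3 / 8 ∧
      max (3 / 8 : ℝ) (max (1 / 4) (1 - 3 / 8 - 1 / 4)) = 3 / 8) := by
  refine ⟨fun γ δ _ _ _ hδ h => ?_, by norm_num⟩
  by_contra! hmax
  obtain ⟨hγ, hδ', hoff⟩ : γ < 3 / 8 ∧ δ < 3 / 8 ∧ 1 - γ - δ < 3 / 8 := by
    simpa only [max_lt_iff] using hmax
  have hpos : 0 < 1 - δ := by linarith
  have hbal : γ * δ ≤ (γ - δ) * (1 - δ) := (div_le_iff₀ hpos).mp (by linarith)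
  have hfactor : 0 < (δ - 1 / 4) * (3 / 2 - δ) := mul_pos (by linarith) (by linarith)
  have hslack : 0 < (3 / 8 - γ) * (1 - 2 * δ) := mul_pos (by linarith) (by linarith)
  linarith
end
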